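/- arXiv:2212.14881 — 4 statements merged into one kernel-verified Lean document; each statement's English description precedes it below -/
import Mathlib

section
/- Let F : ℝ^n → ℝ^n and Φ : ℝ^n → ℝ^s be polynomial maps and let c₀ ∈ ℝ^s. Set A = { x ∈ ℝ^n : x_i > 0 for all i, F(x) = 0, and Φ(x) = c₀ }. Suppose that at every point x ∈ A the Jacobian matrix of the stacked map (F, Φ) : ℝ^n → ℝ^{n+s} at x has rank n. Then A is a finite set. -/
open MvPolynomial

lemma taylor_aux {n : ℕ} (x : Fin n → ℝ) (f : MvPolynomial (Fin n) ℝ) :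
    f - C (eval x f) - ∑ j, C (eval x (pderiv j f)) * (X j - C (x j)) ∈
      (RingHom.ker (eval x)) ^ 2 := by
  induction f using MvPolynomial.induction_on with
  | C a => simp
  | add f g hf hg =>
    have := Ideal.add_mem _ hf hg
    convert this using 1
    simp only [map_add, add_mul, Finset.sum_add_distrib]
    ring
  | mul_X f i hf =>
    have h1 : (X i - C (x i)) * (f - C (eval x f)) ∈ (RingHom.ker (eval x)) ^ 2 := by
      rw [pow_two]
      apply Ideal.mul_mem_mul <;> simp [RingHom.mem_ker]
    have := Ideal.add_mem _ (Ideal.mul_mem_left _ (C (x i)) hf) h1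
    convert this using 1
    have e : ∑ j, C (eval x (pderiv j (f * X i))) * (X j - C (x j)) =
        C (x i) * ∑ j, C (eval x (pderiv j f)) * (X j - C (x j)) +
        C (eval x f) * (X i - C (x i)) := by
      have h2 : C (eval x f) * (X i - C (x i)) =
        ∑ j, (if j = i then C (eval x f) * (X j - C (x j)) else 0) := by simp
      rw [h2, Finset.mul_sum, ← Finset.sum_add_distrib]
      refine Finset.sum_congr rfl fun j _ => ?_
      rw [Derivation.leibniz, pderiv_X]
      by_cases h : j = i
      · subst h
        simp
        ring
      · simp [h, Pi.single_apply, Ne.symm h]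
        try ring
    rw [e]
    simp
    ring

lemma min_aux {R : Type*} [CommRing R] [IsNoetherianRing R] (I m : Ideal R) [hm : m.IsPrime]
    (hI : I ≤ m) (h : m ≤ I ⊔ m ^ 2) : m ∈ I.minimalPrimes := by
  refine ⟨⟨hm, hI⟩, ?_⟩
  rintro P ⟨hP, hIP⟩ hPm
  obtain ⟨r, hr, hr'⟩ := Submodule.exists_sub_one_mem_and_smul_le_of_fg_of_le_sup
    (R := R) (I := m) (N := P) (N' := m) (P := m) (IsNoetherian.noetherian m) le_rfl (by
      refine h.trans (sup_le_sup hIP ?_)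
      rw [pow_two]; exact le_rfl)
  intro y hy
  have h1 : r * y ∈ P := hr' (Submodule.smul_mem_pointwise_smul _ _ _ hy)
  rcases hP.mem_or_mem h1 with h2 | h2
  · exfalso
    apply hm.ne_top
    rw [Ideal.eq_top_iff_one]
    have := m.sub_mem (hPm h2) hr
    simpa using this
  · exact h2

/-- If `F : ℝ^n → ℝ^n` and `Φ : ℝ^n → ℝ^s` are polynomial maps, and at every point of
`A = {x > 0 | F x = 0, Φ x = c₀}` the Jacobian of the stacked map `(F, Φ)` has rank `n`,
then `A` is finite. -/
theorem stmt_2 (n s : ℕ)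
    (p : Fin n → MvPolynomial (Fin n) ℝ) (q : Fin s → MvPolynomial (Fin n) ℝ)
    (F : (Fin n → ℝ) → (Fin n → ℝ)) (Φ : (Fin n → ℝ) → (Fin s → ℝ))
    (hF : ∀ x i, F x i = eval x (p i))
    (hΦ : ∀ x l, Φ x l = eval x (q l))
    (c₀ : Fin s → ℝ)
    (A : Set (Fin n → ℝ))
    (hA : A = {x | (∀ i, 0 < x i) ∧ F x = 0 ∧ Φ x = c₀})
    (hrank : ∀ x ∈ A,
      (Matrix.of fun (a : Fin n ⊕ Fin s) (j : Fin n) =>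
        eval x (pderiv j (Sum.elim p q a))).rank = n) :
    A.Finite := by
  let g : Fin n ⊕ Fin s → MvPolynomial (Fin n) ℝ :=
    fun a => Sum.elim p q a - C (Sum.elim (fun _ => 0) c₀ a)
  let I : Ideal (MvPolynomial (Fin n) ℝ) := Ideal.span (Set.range g)
  refine Set.Finite.of_finite_image (f := fun x => RingHom.ker (eval x)) ?_ ?_
  · refine (Ideal.finite_minimalPrimes_of_isNoetherianRing _ I).subset ?_
    rintro _ ⟨x, hx, rfl⟩
    have hg0 : ∀ a, eval x (g a) = 0 := by
      have hx' := hx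
      rw [hA] at hx'
      obtain ⟨-, h1, h2⟩ := hx'
      rintro (a | a)
      · simp [g, ← hF, h1]
      · simp [g, ← hΦ, h2]
    have hIm : I ≤ RingHom.ker (eval x) := by
      rw [Ideal.span_le]
      rintro _ ⟨a, rfl⟩
      exact hg0 a
    haveI : (RingHom.ker (eval x)).IsPrime := RingHom.ker_isPrime _
    refine min_aux I _ hIm ?_
    intro f hf
    have hr := hrank x hx
    set M := (Matrix.of fun (a : Fin n ⊕ Fin s) (j : Fin n) =>
        eval x (pderiv j (Sum.elim p q a))) with hM
    have hsurj : LinearMap.range M.transpose.mulVecLin = ⊤ := by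
      apply Submodule.eq_top_of_finrank_eq
      rw [← Matrix.rank_transpose] at hr
      rw [Matrix.rank] at hr
      simpa using hr
    obtain ⟨c, hc⟩ := LinearMap.range_eq_top.1 hsurj (fun j => eval x (pderiv j f))
    let w := ∑ a, C (c a) * g a
    have hw : w ∈ I := Ideal.sum_mem _ fun a _ =>
      Ideal.mul_mem_left _ _ (Ideal.subset_span ⟨a, rfl⟩)
    have hd : ∀ j, eval x (pderiv j (f - w)) = 0 := by
      intro j
      have := congrFun hc j
      simp only [Matrix.mulVecLin_apply, Matrix.mulVec, dotProduct] at this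
      rw [map_sub, map_sub, ← this, map_sum, map_sum, sub_eq_zero]
      refine Finset.sum_congr rfl fun a _ => ?_
      simp [hM, g, mul_comm]
    have h0 : eval x (f - w) = 0 := by
      rw [map_sub, hIm hw, (RingHom.mem_ker).1 hf, sub_zero]
    have ht := taylor_aux x (f - w)
    simp only [hd, h0] at ht
    have e : f = w + (f - w) := by ring
    rw [e]
    exact Submodule.add_mem_sup hw (by simpa using ht)
  · intro x _ y _ hxy
    funext i
    have h : (X i - C (x i)) ∈ RingHom.ker (eval x) := by simp [RingHom.mem_ker]
    have hxy' : RingHom.ker (eval x) = RingHom.ker (eval y) := hxy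
    rw [hxy', RingHom.mem_ker] at h
    simp at h
    linarith
end

section
/- Let J be a real n×n matrix, S a real n×r matrix with ρ = rank(S), and C a real (n−ρ)×n matrix whose rows form a basis of the left kernel {v ∈ ℝ^n : vᵀ S = 0} of S. Assume rank(J) = ρ and rank(J·S) = ρ. Then the (2n−ρ)×n matrix obtained by stacking J on top of C has rank n. -/
/-- If `rank J = rank S = ρ`, `rank (J·S) = ρ`, and the rows of `C` form a basis of the
left kernel of `S`, then stacking `J` on top of `C` yields a matrix of rank `n`. -/
theorem stmt_5 (n r : ℕ) (J : Matrix (Fin n) (Fin n) ℝ) (S : Matrix (Fin n) (Fin r) ℝ)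
    (C : Matrix (Fin (n - S.rank)) (Fin n) ℝ)
    (hCind : LinearIndependent ℝ (fun i => C i))
    (hCspan : Submodule.span ℝ (Set.range fun i => C i) = LinearMap.ker S.vecMulLinear)
    (hJ : J.rank = S.rank) (hJS : (J * S).rank = S.rank) :
    (Matrix.fromRows J C).rank = n := by
  have hle : S.rank ≤ n := by simpa using S.rank_le_card_height
  have hK : Module.finrank ℝ (LinearMap.ker S.vecMulLinear) = n - S.rank := by
    rw [← hCspan, finrank_span_eq_card hCind, Fintype.card_fin]
  set W : Submodule ℝ (Fin n → ℝ) := Submodule.span ℝ (Set.range fun i => J i) with hW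
  have hWr : Module.finrank ℝ W = S.rank := by
    rw [← hJ, Matrix.rank_eq_finrank_span_row]; rfl
  have hmap : W.map S.vecMulLinear = Submodule.span ℝ (Set.range fun i => (J * S) i) := by
    rw [hW, Submodule.map_span, ← Set.range_comp]
    rfl
  have hmr : Module.finrank ℝ (W.map S.vecMulLinear) = S.rank := by
    rw [hmap, ← hJS, Matrix.rank_eq_finrank_span_row]; rfl
  have hrn := LinearMap.finrank_range_add_finrank_ker (S.vecMulLinear.domRestrict W)
  rw [LinearMap.range_domRestrict, hmr, hWr] at hrn
  have hker : LinearMap.ker (S.vecMulLinear.domRestrict W) = ⊥ :=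
    Submodule.finrank_eq_zero.mp (by omega)
  have hdis : W ⊓ LinearMap.ker S.vecMulLinear = ⊥ := by
    rw [eq_bot_iff]
    rintro x ⟨hx, hx'⟩
    have : (⟨x, hx⟩ : W) ∈ LinearMap.ker (S.vecMulLinear.domRestrict W) := hx'
    rw [hker, Submodule.mem_bot] at this
    exact congrArg Subtype.val this
  have hsum := Submodule.finrank_sup_add_finrank_inf_eq W (LinearMap.ker S.vecMulLinear)
  rw [hdis, finrank_bot, hWr, hK] at hsum
  have hrows : Submodule.span ℝ (Set.range (Matrix.fromRows J C).row)
      = W ⊔ LinearMap.ker S.vecMulLinear := by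
    rw [← hCspan, hW, ← Submodule.span_union, ← Set.Sum.elim_range]
    congr 2
  rw [Matrix.rank_eq_finrank_span_row, hrows]
  omega
end

section
/- Let F = (f_1,…,f_n) be a vector of polynomials in ℚ[k_1,…,k_r, x_1,…,x_n]. Let C(F) = { φ ∈ ℚ[k,x] : Σ_{i=1}^n (∂φ/∂x_i) f_i = 0 } be the set of polynomial conservation laws, and let Syz_grad(F) = { g ∈ ℚ[k,x]^n : Σ_i g_i f_i = 0 and ∂g_i/∂x_j = ∂g_j/∂x_i for all i, j } be the set of conservative syzygies. Then the gradient map φ ↦ (∂φ/∂x_1,…,∂φ/∂x_n) is a ℚ-linear map from C(F) onto Syz_grad(F) (it is well defined and surjective), and its kernel equals the set of polynomials in C(F) in which none of the variables x_1,…,x_n occurs, i.e., the subring ℚ[k_1,…,k_r] ⊆ C(F). -/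
open MvPolynomial

lemma aux_comm {σ : Type*} (i j : σ) (p : MvPolynomial σ ℚ) :
    pderiv i (pderiv j p) = pderiv j (pderiv i p) := by
  classical
  ext m
  simp only [coeff_pderiv]
  by_cases h : i = j
  · subst h; rfl
  · have h' : j ≠ i := fun e => h e.symm
    rw [add_right_comm]
    simp [h, h']
    ring

lemma aux_euler {σ : Type*} (i : σ) (p : MvPolynomial σ ℚ) (m : σ →₀ ℕ) :
    coeff m (X i * pderiv i p) = (m i : ℚ) * coeff m p := by
  classical
  rw [coeff_X_mul']
  split_ifs with h
  · have hm : m - Finsupp.single i 1 + Finsupp.single i 1 = m := by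
      apply tsub_add_cancel_of_le
      rw [Finsupp.single_le_iff]
      exact Nat.one_le_iff_ne_zero.2 (Finsupp.mem_support_iff.1 h)
    have h2 : (m - Finsupp.single i 1 : σ →₀ ℕ) i + 1 = m i := by
      have := Nat.pos_of_ne_zero (Finsupp.mem_support_iff.1 h)
      simp
      omega
    rw [coeff_pderiv, hm, ← h2]
    push_cast
    ring
  · simp [Finsupp.notMem_support_iff.1 h]

lemma aux_T {σ : Type*} (d : (σ →₀ ℕ) → ℚ) (p : MvPolynomial σ ℚ) :
    ∃ q : MvPolynomial σ ℚ, ∀ m, coeff m q = coeff m p / d m := by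
  classical
  refine ⟨∑ m ∈ p.support, monomial m (coeff m p / d m), fun m => ?_⟩
  rw [coeff_sum]
  simp only [coeff_monomial]
  rw [Finset.sum_ite_eq']
  split_ifs with h
  · rfl
  · rw [notMem_support_iff.1 h]; simp

/-- The gradient map (with respect to the x-variables) is a well-defined, ℚ-linear,
surjective map from the conservation laws `C(F)` onto the conservative syzygies
`Syz_grad(F)`, with kernel the polynomials involving only the `k`-variables. -/
theorem stmt_10 (r n : ℕ) (F : Fin n → MvPolynomial (Fin r ⊕ Fin n) ℚ) :
    let grad : MvPolynomial (Fin r ⊕ Fin n) ℚ → (Fin n → MvPolynomial (Fin r ⊕ Fin n) ℚ) :=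
      fun φ i => pderiv (Sum.inr i) φ
    let CF : Set (MvPolynomial (Fin r ⊕ Fin n) ℚ) :=
      {φ | ∑ i, pderiv (Sum.inr i) φ * F i = 0}
    let SG : Set (Fin n → MvPolynomial (Fin r ⊕ Fin n) ℚ) :=
      {g | ∑ i, g i * F i = 0 ∧
        ∀ i j, pderiv (Sum.inr j) (g i) = pderiv (Sum.inr i) (g j)}
    (∀ φ ∈ CF, grad φ ∈ SG) ∧
    (∀ (c : ℚ), ∀ φ ∈ CF, ∀ ψ ∈ CF, grad (c • φ + ψ) = c • grad φ + grad ψ) ∧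
    (∀ g ∈ SG, ∃ φ ∈ CF, grad φ = g) ∧
    (∀ φ ∈ CF, (grad φ = 0 ↔ ∃ ψ : MvPolynomial (Fin r) ℚ, φ = rename Sum.inl ψ)) := by
  intro grad CF SG
  have hsurj : ∀ g ∈ SG, ∃ φ ∈ CF, grad φ = g := by
    rintro g ⟨hg, hc⟩
    obtain ⟨φ, hφ⟩ := aux_T (fun m : (Fin r ⊕ Fin n) →₀ ℕ => ∑ j : Fin n, (m (Sum.inr j) : ℚ))
      (∑ j, X (Sum.inr j) * g j)
    have key : grad φ = g := by
      funext i
      ext m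
      change coeff m (pderiv (Sum.inr i) φ) = _
      have h1 : pderiv (Sum.inr i) (∑ j, X (Sum.inr j) * g j)
          = g i + ∑ j, X (Sum.inr j) * pderiv (Sum.inr j) (g i) := by
        rw [map_sum]
        simp only [pderiv_mul, Finset.sum_add_distrib]
        congr 1
        · rw [Finset.sum_eq_single i]
          · simp
          · intro j _ hj
            rw [pderiv_X_of_ne (by simpa using hj), zero_mul]
          · simp
        · exact Finset.sum_congr rfl fun j _ => by rw [hc]
      have h2 := congrArg (coeff m) h1
      have h5 : coeff m (∑ j, X (Sum.inr j) * pderiv (Sum.inr j) (g i))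
          = (∑ j : Fin n, (m (Sum.inr j) : ℚ)) * coeff m (g i) := by
        rw [coeff_sum, Finset.sum_mul]
        exact Finset.sum_congr rfl fun j _ => aux_euler _ _ _
      rw [coeff_pderiv, coeff_add, h5] at h2
      have h3 : ∑ j : Fin n, (((m + Finsupp.single (Sum.inr i) 1 : (Fin r ⊕ Fin n) →₀ ℕ) (Sum.inr j) : ℕ) : ℚ)
          = ∑ j : Fin n, (m (Sum.inr j) : ℚ) + 1 := by
        simp [Finset.sum_add_distrib, Finsupp.single_apply]
      have h4 : (∑ j : Fin n, (m (Sum.inr j) : ℚ)) + 1 ≠ 0 := by positivity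
      rw [coeff_pderiv, hφ, h3, div_mul_eq_mul_div, div_eq_iff h4, h2]
      ring
    refine ⟨φ, ?_, key⟩
    change ∑ i, grad φ i * F i = 0
    rw [key]; exact hg
  refine ⟨fun φ hφ => ⟨hφ, fun i j => aux_comm _ _ _⟩, ?_, hsurj, ?_⟩
  · intro c φ _ ψ _
    funext i
    simp [grad]
  · intro φ _
    constructor
    · intro h
      have hv : (φ.vars : Set (Fin r ⊕ Fin n)) ⊆ Set.range Sum.inl := by
        rintro (a | i) ha
        · exact ⟨a, rfl⟩
        · exfalso
          obtain ⟨m, hm, hmi⟩ := (mem_vars_iff_mem_support _).1 (Finset.mem_coe.1 ha)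
          have h1 := aux_euler (Sum.inr i) φ m
          have h0 : pderiv (Sum.inr i) φ = 0 := congrFun h i
          rw [h0, mul_zero, coeff_zero] at h1
          rcases mul_eq_zero.1 h1.symm with h2 | h2
          · exact Finsupp.mem_support_iff.1 hmi (by exact_mod_cast h2)
          · exact mem_support_iff.1 hm h2
      obtain ⟨ψ, hψ⟩ := exists_rename_eq_of_vars_subset_range φ Sum.inl Sum.inl_injective hv
      exact ⟨ψ, hψ.symm⟩
    · rintro ⟨ψ, rfl⟩
      funext i
      change pderiv (Sum.inr i) (rename Sum.inl ψ) = 0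
      apply pderiv_eq_zero_of_notMem_vars
      classical
      intro hi
      have := vars_rename Sum.inl ψ hi
      simp at this
end

section
/- Let S ∈ ℤ^{n×r}, let α_1,…,α_r ∈ ℕ^n be multi-indices, let k_1,…,k_r > 0, and define F : ℝ^n → ℝ^n by F_i(x) = Σ_{j=1}^r S_{ij}·k_j·x_1^{α_{j,1}}⋯x_n^{α_{j,n}}. Assume that for all i and j, if S_{ij} < 0 then α_{j,i} > 0. Let T > 0 and let x : [0,T] → ℝ^n be differentiable with x'(t) = F(x(t)) for all t ∈ [0,T] and with x_i(0) ≥ 0 for all i. Then x_i(t) ≥ 0 for all i and all t ∈ [0,T]. -/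
theorem aux_hasDeriv (u : ℝ) : HasDerivAt (fun v : ℝ => (min v 0)^2) (2 * min u 0) u := by
  rcases lt_trichotomy u 0 with h | h | h
  · have h1 : HasDerivAt (fun v : ℝ => v^2) (2 * u) u := by simpa using hasDerivAt_pow 2 u
    rw [min_eq_left h.le]
    refine h1.congr_of_eventuallyEq ?_
    filter_upwards [gt_mem_nhds h] with v hv
    rw [min_eq_left (le_of_lt hv)]
  · subst h
    rw [hasDerivAt_iff_isLittleO_nhds_zero]
    have h2 : (fun h : ℝ => h^2) =o[nhds 0] (fun h : ℝ => h) := by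
      simpa using (Asymptotics.isLittleO_pow_pow (𝕜 := ℝ) (m := 1) (n := 2) (by norm_num))
    refine Asymptotics.IsBigO.trans_isLittleO (Asymptotics.IsBigO.of_bound 1 ?_) h2
    filter_upwards with v
    simp only [zero_add, min_self, mul_zero, smul_zero, sub_zero, Real.norm_eq_abs, one_mul, ne_eq,
      OfNat.ofNat_ne_zero, not_false_eq_true, zero_pow]
    rw [abs_of_nonneg (sq_nonneg _), abs_of_nonneg (sq_nonneg _)]
    rcases le_total v 0 with h | h
    · simp [h]
    · simp [h]
  · rw [min_eq_right h.le]
    refine ((hasDerivAt_const u (0:ℝ)).congr_of_eventuallyEq ?_).congr_deriv (by simp)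
    filter_upwards [lt_mem_nhds h] with v hv
    simp [min_eq_right (le_of_lt hv)]

/-- For a CRN vector field `F_i(x) = Σ_j S_{ij} k_j x^{α_j}` with positive rate constants,
if `α_{j,i} > 0` whenever `S_{ij} < 0`, then any solution of `ẋ = F(x)` on `[0,T]`
starting in the nonnegative orthant stays in the nonnegative orthant. -/
theorem stmt_16 (n r : ℕ) (S : Matrix (Fin n) (Fin r) ℤ) (α : Fin r → Fin n → ℕ)
    (k : Fin r → ℝ) (hk : ∀ j, 0 < k j)
    (F : (Fin n → ℝ) → (Fin n → ℝ))
    (hFdef : ∀ x i, F x i = ∑ j, (S i j : ℝ) * k j * ∏ t, x t ^ α j t)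
    (hα : ∀ i j, S i j < 0 → 0 < α j i)
    (T : ℝ) (hT : 0 < T)
    (x : ℝ → Fin n → ℝ)
    (hx : ∀ t ∈ Set.Icc (0 : ℝ) T, HasDerivWithinAt x (F (x t)) (Set.Icc 0 T) t)
    (hx0 : ∀ i, 0 ≤ x 0 i) :
    ∀ t ∈ Set.Icc (0 : ℝ) T, ∀ i, 0 ≤ x t i := by
  have hFc : ContDiff ℝ 1 F := by
    rw [contDiff_pi]
    intro i
    have : (fun y => F y i) = fun y => ∑ j, (S i j : ℝ) * k j * ∏ t, y t ^ α j t :=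
      funext fun y => hFdef y i
    rw [this]
    refine ContDiff.sum fun j _ => contDiff_const.mul (contDiff_prod fun t _ => ?_)
    exact (contDiff_apply ℝ ℝ t).pow _
  have hxc : ContinuousOn x (Set.Icc 0 T) := fun t ht => (hx t ht).continuousWithinAt
  obtain ⟨R, hR⟩ := isCompact_Icc.exists_bound_of_continuousOn hxc
  obtain ⟨K, hK⟩ := hFc.contDiffOn.exists_lipschitzOnWith (by norm_num)
    (convex_closedBall (0 : Fin n → ℝ) R) (isCompact_closedBall (0 : Fin n → ℝ) R)
  -- quasi-positivity
  have hq : ∀ y : Fin n → ℝ, (∀ i, 0 ≤ y i) → ∀ i, y i = 0 → 0 ≤ F y i := by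
    intro y hy i hi
    rw [hFdef]
    refine Finset.sum_nonneg fun j _ => ?_
    have hp : 0 ≤ ∏ t, y t ^ α j t := Finset.prod_nonneg fun t _ => pow_nonneg (hy t) _
    rcases lt_or_ge (S i j) 0 with h | h
    · have : ∏ t, y t ^ α j t = 0 :=
        Finset.prod_eq_zero (Finset.mem_univ i) (by rw [hi]; exact zero_pow (hα i j h).ne')
      simp [this]
    · have h' : (0:ℝ) ≤ S i j := by exact_mod_cast h
      exact mul_nonneg (mul_nonneg h' (hk j).le) hp
  have hkey : ∀ t ∈ Set.Icc (0:ℝ) T, ∀ i,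
      min (x t i) 0 * F (x t) i ≤ |min (x t i) 0| * (K * ∑ j, |min (x t j) 0|) := by
    intro t ht i
    rcases le_or_gt 0 (x t i) with h | h
    · simp [min_eq_right h]
    set y : Fin n → ℝ := fun j => max (x t j) 0 with hy
    have hyR : ‖y‖ ≤ R := by
      refine (pi_norm_le_iff_of_nonneg ((norm_nonneg _).trans (hR t ht))).2 fun j => ?_
      refine le_trans ?_ ((norm_le_pi_norm (x t) j).trans (hR t ht))
      rw [Real.norm_eq_abs, Real.norm_eq_abs, abs_of_nonneg (le_max_right _ _)]
      exact max_le (le_abs_self _) (abs_nonneg _)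
    have h1 := hK.dist_le_mul (x t) (by simpa using hR t ht) y (by simpa using hyR)
    have h2 : dist (F (x t) i) (F y i) ≤ dist (F (x t)) (F y) := dist_le_pi_dist _ _ i
    have h3 : dist (x t) y ≤ ∑ j, |min (x t j) 0| := by
      refine (dist_pi_le_iff (Finset.sum_nonneg fun j _ => abs_nonneg _)).2 fun j => ?_
      refine le_trans ?_ (Finset.single_le_sum (f := fun j => |min (x t j) 0|)
        (fun j _ => abs_nonneg _) (Finset.mem_univ j))
      have := min_add_max (x t j) 0
      rw [Real.dist_eq]
      apply le_of_eq
      congr 1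
      simp only [hy]
      linarith
    have h4 : 0 ≤ F y i := hq y (fun j => le_max_right _ _) i (max_eq_right h.le)
    have h5 : K * dist (x t) y ≤ K * ∑ j, |min (x t j) 0| :=
      mul_le_mul_of_nonneg_left h3 K.2
    rw [Real.dist_eq] at h2
    have h6 := neg_abs_le (F (x t) i - F y i)
    have h7 : -F (x t) i ≤ K * ∑ j, |min (x t j) 0| := by linarith
    rw [min_eq_left h.le, abs_of_neg h]
    nlinarith
  set V : ℝ → ℝ := fun t => ∑ i, (min (x t i) 0)^2 with hV
  set C : ℝ := 2 * K * n with hC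
  have hVd : ∀ t ∈ Set.Ioo (0:ℝ) T,
      HasDerivAt V (∑ i, 2 * min (x t i) 0 * F (x t) i) t := by
    intro t ht
    have h := (hx t (Set.Ioo_subset_Icc_self ht)).hasDerivAt (Icc_mem_nhds ht.1 ht.2)
    rw [hasDerivAt_pi] at h
    exact HasDerivAt.fun_sum fun i _ =>
      HasDerivAt.comp (h₂ := fun v : ℝ => (min v 0)^2) t (aux_hasDeriv (x t i)) (h i)
  have hVb : ∀ t ∈ Set.Icc (0:ℝ) T, ∑ i, 2 * min (x t i) 0 * F (x t) i ≤ C * V t := by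
    intro t ht
    have h1 : ∑ i, 2 * min (x t i) 0 * F (x t) i ≤
        ∑ i, 2 * (|min (x t i) 0| * (K * ∑ j, |min (x t j) 0|)) :=
      Finset.sum_le_sum fun i _ => by have := hkey t ht i; linarith
    rw [← Finset.mul_sum, ← Finset.sum_mul] at h1
    have h2 := sq_sum_le_card_mul_sum_sq (s := Finset.univ) (f := fun i => |min (x t i) 0|)
    simp only [sq_abs, Finset.card_univ, Fintype.card_fin] at h2
    have h3 := mul_le_mul_of_nonneg_left h2 (show (0:ℝ) ≤ 2 * K from by positivity)
    simp only [hC, hV]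
    linarith
  have hanti : AntitoneOn (fun t => V t * Real.exp (-C * t)) (Set.Icc 0 T) := by
    have hd : ∀ t ∈ Set.Ioo (0:ℝ) T, HasDerivAt (fun t => V t * Real.exp (-C * t))
        ((∑ i, 2 * min (x t i) 0 * F (x t) i) * Real.exp (-C * t)
          + V t * (Real.exp (-C * t) * (-C))) t := by
      intro t ht
      have he : HasDerivAt (fun t => Real.exp (-C * t)) (Real.exp (-C * t) * (-C)) t := by
        simpa using ((hasDerivAt_id t).const_mul (-C)).exp
      exact (hVd t ht).mul he
    refine antitoneOn_of_deriv_nonpos (convex_Icc 0 T) ?_ ?_ ?_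
    · refine ContinuousOn.mul ?_ (by fun_prop)
      refine continuousOn_finsetSum _ fun i _ => ?_
      have := continuousOn_pi.1 hxc i
      exact (this.inf continuousOn_const).pow 2
    · rw [interior_Icc]
      exact fun t ht => (hd t ht).differentiableAt.differentiableWithinAt
    · rw [interior_Icc]
      intro t ht
      rw [(hd t ht).deriv]
      have := hVb t (Set.Ioo_subset_Icc_self ht)
      have := Real.exp_pos (-C * t)
      nlinarith
  intro t ht i
  have h0 : V 0 = 0 := by
    simp [hV, min_eq_right (hx0 _)]
  have h1 := hanti (Set.left_mem_Icc.2 hT.le) ht ht.1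
  simp only [h0, zero_mul] at h1
  have h2 : V t ≤ 0 := by
    by_contra hc
    have := mul_pos (not_le.1 hc) (Real.exp_pos (-C * t))
    linarith
  have h3 : (min (x t i) 0)^2 ≤ V t :=
    Finset.single_le_sum (f := fun i => (min (x t i) 0)^2)
      (fun j _ => sq_nonneg _) (Finset.mem_univ i)
  have h4 : min (x t i) 0 = 0 := by
    have : (min (x t i) 0)^2 = 0 := le_antisymm (h3.trans h2) (sq_nonneg _)
    exact pow_eq_zero_iff (two_ne_zero) |>.1 this
  exact min_eq_right_iff.1 h4
end
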